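/- Assume the basic parameter conditions δ_L > 0, δ_R > 0, τ_L > δ_L + 1, τ_R < -(δ_R + 1). There exists c > 1 with the following property: for every z ∈ ℝ² whose forward orbit avoids the switching manifold (i.e., the first coordinate of f^i(z) is nonzero for all i ≥ 0), defining M_i = A_L if the first coordinate of f^i(z) is negative and M_i = A_R if it is positive, one has ‖M_{n-1}·⋯·M_1·M_0·(1,0)‖ ≥ cⁿ for all n ≥ 1; consequently liminf_{n→∞} (1/n)·ln‖M_{n-1}·⋯·M_0·(1,0)‖ ≥ ln c > 0, so the Lyapunov exponent of z in the direction (1,0), when it exists, is positive. -/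

import Mathlib

/-- The 2D border-collision normal form. -/
noncomputable def bcnf (τL δL τR δR : ℝ) (p : ℝ × ℝ) : ℝ × ℝ :=
  if p.1 ≤ 0 then (τL * p.1 + p.2 + 1, -δL * p.1)
  else (τR * p.1 + p.2 + 1, -δR * p.1)

/-- The Euclidean norm on `Fin 2 → ℝ`. -/
noncomputable def euclNorm (v : Fin 2 → ℝ) : ℝ := Real.sqrt (v 0 ^ 2 + v 1 ^ 2)

/-- `applyMats M n v = M_{n-1} ⋯ M_1 M_0 v`. -/
def applyMats (M : ℕ → Matrix (Fin 2) (Fin 2) ℝ) : ℕ → (Fin 2 → ℝ) → Fin 2 → ℝ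
  | 0, v => v
  | n + 1, v => (M n).mulVec (applyMats M n v)

/-- The cone of slopes `[-δL, δR]` is invariant under any product of the two Jacobian matrices, and
the first coordinate of a vector in the cone is scaled by a factor between `c` and `K`. -/
lemma applyMats_mem_cone {τL δL τR δR c K : ℝ} (hδL : 0 < δL) (hδR : 0 < δR) (hc : 1 < c)
    (hcL : c ≤ τL - δL) (hcR : c ≤ -τR - δR) (hKL : τL + δR ≤ K) (hKR : δL - τR ≤ K)
    {M : ℕ → Matrix (Fin 2) (Fin 2) ℝ}
    (hM : ∀ i, M i = !![τL, 1; -δL, 0] ∨ M i = !![τR, 1; -δR, 0]) (n : ℕ) :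
    ∃ m, -δL ≤ m ∧ m ≤ δR ∧ applyMats M n ![1, 0] 1 = m * applyMats M n ![1, 0] 0 ∧
      c ^ n ≤ |applyMats M n ![1, 0] 0| ∧ |applyMats M n ![1, 0] 0| ≤ K ^ n := by
  induction n with
  | zero => exact ⟨0, by linarith, hδR.le, by simp [applyMats], by simp [applyMats],
      by simp [applyMats]⟩
  | succ n ih =>
    obtain ⟨m, hm1, hm2, hy, hlo, hhi⟩ := ih
    have step : ∀ τ δ : ℝ, M n = !![τ, 1; -δ, 0] → c ≤ |τ + m| → |τ + m| ≤ K →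
        -δL ≤ -δ / (τ + m) → -δ / (τ + m) ≤ δR →
        ∃ m, -δL ≤ m ∧ m ≤ δR ∧
          applyMats M (n + 1) ![1, 0] 1 = m * applyMats M (n + 1) ![1, 0] 0 ∧
          c ^ (n + 1) ≤ |applyMats M (n + 1) ![1, 0] 0| ∧
          |applyMats M (n + 1) ![1, 0] 0| ≤ K ^ (n + 1) := by
      intro τ δ hMn hcm hmK h1 h2
      have hne : τ + m ≠ 0 := abs_pos.mp (by linarith)
      have e0 : applyMats M (n + 1) ![1, 0] 0 = (τ + m) * applyMats M n ![1, 0] 0 := by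
        simp only [applyMats, hMn, Matrix.mulVec, dotProduct, Fin.sum_univ_two]
        simp [hy]; ring
      have e1 : applyMats M (n + 1) ![1, 0] 1 = -δ * applyMats M n ![1, 0] 0 := by
        simp only [applyMats, hMn, Matrix.mulVec, dotProduct, Fin.sum_univ_two]
        simp
      refine ⟨-δ / (τ + m), h1, h2, ?_, ?_, ?_⟩
      · rw [e0, e1]; field_simp
      · rw [e0, abs_mul, pow_succ']
        gcongr
      · rw [e0, abs_mul, pow_succ']
        gcongr
        linarith
    rcases hM n with h | h
    · have hp : 0 < τL + m := by linarith
      refine step _ _ h ?_ ?_ ?_ ?_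
      · rw [abs_of_pos hp]; linarith
      · rw [abs_of_pos hp]; linarith
      · rw [le_div_iff₀ hp]; nlinarith
      · rw [div_le_iff₀ hp]; nlinarith
    · have hp : τR + m < 0 := by linarith
      refine step _ _ h ?_ ?_ ?_ ?_
      · rw [abs_of_neg hp]; linarith
      · rw [abs_of_neg hp]; linarith
      · rw [le_div_iff_of_neg hp]; nlinarith
      · rw [div_le_iff_of_neg hp]; nlinarith

lemma abs_le_euclNorm (v : Fin 2 → ℝ) : |v 0| ≤ euclNorm v :=
  Real.abs_le_sqrt (by nlinarith [sq_nonneg (v 1)])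

lemma euclNorm_le_abs_add_abs (v : Fin 2 → ℝ) : euclNorm v ≤ |v 0| + |v 1| := by
  refine Real.sqrt_le_iff.mpr ⟨by positivity, ?_⟩
  nlinarith [sq_abs (v 0), sq_abs (v 1), mul_nonneg (abs_nonneg (v 0)) (abs_nonneg (v 1))]

/-- A sequence pinched between `c ^ n` and `K ^ (n + 1)` has lower exponential growth rate at least
`log c`. -/
lemma log_le_liminf_of_pow_le {u : ℕ → ℝ} {c K : ℝ} (hc : 1 < c) (hK : 1 ≤ K)
    (hlo : ∀ n, c ^ n ≤ u n) (hhi : ∀ n, u n ≤ K ^ (n + 1)) :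
    Real.log c ≤ Filter.liminf (fun n : ℕ => (1 / (n : ℝ)) * Real.log (u n)) Filter.atTop := by
  have hpos : ∀ n, 0 < u n := fun n => (pow_pos (by linarith) n).trans_le (hlo n)
  apply Filter.le_liminf_of_le
  · apply Filter.IsBoundedUnder.isCoboundedUnder_ge
    refine Filter.isBoundedUnder_of_eventually_le (a := 2 * Real.log K) ?_
    filter_upwards [Filter.eventually_ge_atTop 1] with n hn
    have hn' : (1 : ℝ) ≤ n := by exact_mod_cast hn
    have h := Real.log_le_log (hpos n) (hhi n)
    rw [Real.log_pow] at h
    push_cast at h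
    rw [one_div_mul_eq_div, div_le_iff₀ (by linarith)]
    nlinarith [Real.log_nonneg hK]
  · filter_upwards [Filter.eventually_ge_atTop 1] with n hn
    have hn' : (1 : ℝ) ≤ n := by exact_mod_cast hn
    have h := Real.log_le_log (pow_pos (by linarith) n) (hlo n)
    rw [Real.log_pow] at h
    rw [one_div_mul_eq_div, le_div_iff₀ (by linarith)]
    linarith

/-- there exists `c > 1` (with `ln c > 0`) such that for every
orbit avoiding the switching manifold, the products of Jacobian matrices along
the orbit expand the vector `(1,0)` by at least `cⁿ`, and consequently the
liminf defining the Lyapunov exponent in direction `(1,0)` is at least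
`ln c > 0`. -/
theorem stmt11 (τL δL τR δR : ℝ)
    (hδL : 0 < δL) (hδR : 0 < δR)
    (hτL : τL > δL + 1) (hτR : τR < -(δR + 1))
    (AL AR : Matrix (Fin 2) (Fin 2) ℝ)
    (hAL : AL = !![τL, 1; -δL, 0]) (hAR : AR = !![τR, 1; -δR, 0]) :
    ∃ c : ℝ, 1 < c ∧ 0 < Real.log c ∧
      ∀ z : ℝ × ℝ, (∀ i : ℕ, ((bcnf τL δL τR δR)^[i] z).1 ≠ 0) →
        ∀ M : ℕ → Matrix (Fin 2) (Fin 2) ℝ,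
          (∀ i : ℕ, M i = if ((bcnf τL δL τR δR)^[i] z).1 < 0 then AL else AR) →
          (∀ n : ℕ, 1 ≤ n → euclNorm (applyMats M n ![1, 0]) ≥ c ^ n) ∧
          Filter.liminf
            (fun n : ℕ => (1 / (n : ℝ)) * Real.log (euclNorm (applyMats M n ![1, 0])))
            Filter.atTop ≥ Real.log c := by
  have hc : 1 < min (τL - δL) (-τR - δR) := lt_min (by linarith) (by linarith)
  refine ⟨min (τL - δL) (-τR - δR), hc, Real.log_pos hc, fun z _ M hM => ?_⟩
  have hM' : ∀ i, M i = !![τL, 1; -δL, 0] ∨ M i = !![τR, 1; -δR, 0] := fun i => by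
    rw [hM i, hAL, hAR]
    exact ite_eq_or_eq _ _ _
  have key := applyMats_mem_cone (K := τL - τR + δL + δR + 1) hδL hδR hc
    (min_le_left _ _) (min_le_right _ _) (by linarith) (by linarith) hM'
  have hlo : ∀ n, min (τL - δL) (-τR - δR) ^ n ≤ euclNorm (applyMats M n ![1, 0]) := fun n => by
    obtain ⟨m, -, -, -, h, -⟩ := key n
    exact h.trans (abs_le_euclNorm _)
  refine ⟨fun n _ => hlo n, log_le_liminf_of_pow_le hc
    (K := τL - τR + δL + δR + 1) (by linarith) hlo fun n => ?_⟩
  obtain ⟨m, hm1, hm2, hy, -, h⟩ := key n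
  have hm : 1 + |m| ≤ τL - τR + δL + δR + 1 := by
    have : |m| ≤ δL + δR := abs_le.mpr ⟨by linarith, by linarith⟩
    linarith
  calc euclNorm (applyMats M n ![1, 0])
      ≤ (1 + |m|) * |applyMats M n ![1, 0] 0| := by
        refine (euclNorm_le_abs_add_abs _).trans_eq ?_
        rw [hy, abs_mul]
        ring
    _ ≤ (τL - τR + δL + δR + 1) ^ (n + 1) := by
        rw [pow_succ']
        gcongr
        linarith
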